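/- Let X, Z be orthonormal bases of C^d with c = max_{j,k}|⟨X_j|Z_k⟩|², and let ρ_{SS'} be any density operator on C^d ⊗ H_{S'}. Let ρ^{(2)}_{SS'} = (D_Z ∘ D_X ⊗ id_{S'})(ρ_{SS'}) be the state after sequentially dephasing system S in the X and then the Z basis. Then D(ρ^{(2)}_{SS'} ‖ (I/d) ⊗ ρ^{(2)}_{S'}) ≤ log(d·c). -/

import Mathlib

open scoped BigOperators ComplexOrder
open Matrix Finset

noncomputable def overlap {d : ℕ} (X Z : Fin d → Fin d → ℂ) (j k : Fin d) : ℂ :=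
  ∑ i, star (X j i) * Z k i

/-- `X` is an orthonormal basis of `ℂ^d` (d orthonormal vectors). -/
def IsONB {d : ℕ} (X : Fin d → Fin d → ℂ) : Prop :=
  ∀ j k, (∑ i, star (X j i) * X k i) = if j = k then (1 : ℂ) else 0

/-- matrix logarithm (base 2) of a Hermitian matrix, via its spectral decomposition. -/
noncomputable def mlog {n : Type*} [Fintype n] [DecidableEq n] (A : Matrix n n ℂ) :
    Matrix n n ℂ :=
  if h : A.IsHermitian then
    (h.eigenvectorUnitary : Matrix n n ℂ) *
      Matrix.diagonal (fun i => (Real.logb 2 (h.eigenvalues i) : ℂ)) *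
      (star (h.eigenvectorUnitary : Matrix n n ℂ))
  else 0

/-- quantum relative entropy D(ρ‖σ) (base 2). -/
noncomputable def relEntropy {n : Type*} [Fintype n] [DecidableEq n]
    (ρ σ : Matrix n n ℂ) : ℝ :=
  ((ρ * (mlog ρ - mlog σ)).trace).re

/-- partial trace over the first tensor factor S. -/
noncomputable def trS {a b : Type*} [Fintype a] [Fintype b] (ρ : Matrix (a × b) (a × b) ℂ) :
    Matrix b b ℂ := Matrix.of fun i j => ∑ k, ρ (k, i) (k, j)

/-- the projector |X_j⟩⟨X_j| ⊗ I on S ⊗ S'. -/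
noncomputable def projS {d : ℕ} {s' : Type*} [Fintype s'] [DecidableEq s']
    (X : Fin d → Fin d → ℂ) (j : Fin d) :
    Matrix (Fin d × s') (Fin d × s') ℂ :=
  Matrix.of fun p q => X j p.1 * star (X j q.1) * (if p.2 = q.2 then 1 else 0)

/-- dephasing of the S factor in the X basis. -/
noncomputable def dephS {d : ℕ} {s' : Type*} [Fintype s'] [DecidableEq s']
    (X : Fin d → Fin d → ℂ) (ρ : Matrix (Fin d × s') (Fin d × s') ℂ) :
    Matrix (Fin d × s') (Fin d × s') ℂ :=
  ∑ j, projS X j * ρ * projS X j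

open scoped MatrixOrder Matrix.Norms.L2Operator Topology Kronecker

section aux
variable {n : Type*} [Fintype n] [DecidableEq n]

lemma aux_cont (B : Matrix n n ℂ) (f : ℝ → ℝ) : ContinuousOn f (spectrum ℝ B) := by
  have : (spectrum ℝ B).Finite := Matrix.finite_real_spectrum
  exact this.continuousOn f

lemma aux_mlog {B : Matrix n n ℂ} (hB : B.IsHermitian) :
    mlog B = cfc (Real.logb 2) B := by
  rw [hB.cfc_eq, mlog, dif_pos hB, Matrix.IsHermitian.cfc, Unitary.conjStarAlgAut_apply]
  rfl

/-- diagonal weights of `A` in the eigenbasis of `B` -/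
noncomputable def auxW {B : Matrix n n ℂ} (hB : B.IsHermitian) (A : Matrix n n ℂ) (i : n) : ℝ :=
  ((star (hB.eigenvectorUnitary : Matrix n n ℂ) * A * (hB.eigenvectorUnitary : Matrix n n ℂ)) i i).re

lemma aux_tr_cfc {B : Matrix n n ℂ} (hB : B.IsHermitian) (A : Matrix n n ℂ) (f : ℝ → ℝ) :
    ((A * cfc f B).trace).re = ∑ i, auxW hB A i * f (hB.eigenvalues i) := by
  rw [hB.cfc_eq, Matrix.IsHermitian.cfc, Unitary.conjStarAlgAut_apply]
  rw [← mul_assoc, Matrix.trace_mul_comm, ← mul_assoc, ← mul_assoc]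
  simp [Matrix.trace, Matrix.mul_diagonal, auxW]

lemma aux_sumW {B : Matrix n n ℂ} (hB : B.IsHermitian) (A : Matrix n n ℂ) :
    ∑ i, auxW hB A i = A.trace.re := by
  have := aux_tr_cfc hB A (fun _ => 1)
  have h1 : cfc (fun _ : ℝ => (1:ℝ)) B = 1 := cfc_const_one ℝ B hB
  rw [h1] at this
  simpa using this.symm

lemma aux_W_nonneg {B : Matrix n n ℂ} (hB : B.IsHermitian) {A : Matrix n n ℂ}
    (hA : A.PosSemidef) (i : n) : 0 ≤ auxW hB A i := by
  have := (hA.conjTranspose_mul_mul_same (hB.eigenvectorUnitary : Matrix n n ℂ)).diag_nonneg (i := i)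
  exact (Complex.le_def.1 this).1

lemma aux_W_self {B : Matrix n n ℂ} (hB : B.IsHermitian) (i : n) :
    auxW hB B i = hB.eigenvalues i := by
  have := hB.conjStarAlgAut_star_eigenvectorUnitary
  rw [Unitary.conjStarAlgAut_apply] at this
  simp only [Unitary.coe_star, star_star] at this
  rw [auxW, this]
  simp

lemma aux_W_zero {B : Matrix n n ℂ} (hB : B.IsHermitian) {A : Matrix n n ℂ}
    (hA : A.PosSemidef) (l : ℝ) (h : (l • B - A).PosSemidef) (i : n) (hi : hB.eigenvalues i = 0) :
    auxW hB A i = 0 := by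
  refine le_antisymm ?_ (aux_W_nonneg hB hA i)
  have h1 := aux_W_nonneg hB h i
  have h2 : auxW hB (l • B - A) i = l * auxW hB B i - auxW hB A i := by
    simp [auxW, Matrix.mul_sub, Matrix.sub_mul]
  rw [h2, aux_W_self, hi] at h1
  linarith

lemma aux_mono {A B : Matrix n n ℂ} (hA : A.PosSemidef) (hB : B.PosSemidef) {l e : ℝ}
    (hl : 0 < l) (he : 0 < e) (h : (l • B - A).PosSemidef) :
    cfc (fun x => Real.log (x + l * e)) A ≤ cfc (fun x => Real.log (l * (x + e))) B := by
  have e1 : cfc (fun x => Real.log (x + l * e)) A = CFC.log (A + algebraMap ℝ _ (l * e)) := by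
    have hsa : IsSelfAdjoint A := hA.1
    rw [CFC.log]
    have : A + algebraMap ℝ _ (l * e) = cfc (fun x : ℝ => x + l * e) A := by
      rw [cfc_add_const (l*e) (fun x => x) A, cfc_id' ℝ A]
    rw [this, ← cfc_comp' Real.log (fun x : ℝ => x + l * e) A
      (((Matrix.finite_real_spectrum (A := A)).image _).continuousOn _) (aux_cont _ _)]
  have e2 : cfc (fun x => Real.log (l * (x + e))) B
      = CFC.log (l • B + algebraMap ℝ _ (l * e)) := by
    have hsa : IsSelfAdjoint B := hB.1
    rw [CFC.log]
    have : l • B + algebraMap ℝ _ (l * e) = cfc (fun x : ℝ => l * (x + e)) B := by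
      simp only [mul_add]
      rw [cfc_add_const (l*e) (fun x => l * x) B, cfc_const_mul_id l B]
    rw [this, ← cfc_comp' Real.log (fun x : ℝ => l * (x + e)) B
      (((Matrix.finite_real_spectrum (A := B)).image _).continuousOn _) (aux_cont _ _)]
  rw [e1, e2]
  apply CFC.log_le_log
  · rw [Matrix.le_iff]
    simpa using h
  · rw [Matrix.isStrictlyPositive_iff_posDef]
    refine Matrix.PosDef.posSemidef_add hA ?_
    rw [Algebra.algebraMap_eq_smul_one]
    exact Matrix.PosDef.one.smul (by positivity)

lemma aux_trace_le {A M N : Matrix n n ℂ} (hA : A.PosSemidef) (h : M ≤ N) :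
    ((A * M).trace).re ≤ ((A * N).trace).re := by
  have h' : (N - M).PosSemidef := h
  have : 0 ≤ ((A * (N - M)).trace).re := by
    obtain ⟨C, rfl⟩ := CStarAlgebra.nonneg_iff_eq_star_mul_self.1 hA.nonneg
    rw [Matrix.star_eq_conjTranspose, Matrix.mul_assoc, Matrix.trace_mul_comm]
    exact (Complex.le_def.1 (h'.mul_mul_conjTranspose_same C).trace_nonneg).1
  rw [Matrix.mul_sub, Matrix.trace_sub, Complex.sub_re] at this
  linarith

lemma aux_relEntropy {A B : Matrix n n ℂ} (hA : A.PosSemidef) (hB : B.PosSemidef) {l : ℝ}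
    (hl : 0 < l) (h : (l • B - A).PosSemidef) (htr : A.trace = 1) :
    relEntropy A B ≤ Real.logb 2 l := by
  have key : ∀ e : ℝ, 0 < e →
      ∑ i, auxW hA.1 A i * Real.log (hA.1.eigenvalues i + l * e) ≤
      ∑ i, auxW hB.1 A i * Real.log (l * (hB.1.eigenvalues i + e)) := by
    intro e he
    have := aux_trace_le hA (aux_mono hA hB hl he h)
    rwa [aux_tr_cfc hA.1, aux_tr_cfc hB.1] at this
  have l1 : Filter.Tendsto
      (fun e : ℝ => ∑ i, auxW hA.1 A i * Real.log (hA.1.eigenvalues i + l * e)) (𝓝[>] 0)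
      (𝓝 (∑ i, auxW hA.1 A i * Real.log (hA.1.eigenvalues i))) := by
    refine tendsto_finsetSum _ fun i _ => ?_
    by_cases hi : hA.1.eigenvalues i = 0
    · simp [aux_W_self, hi]
    · refine (Filter.Tendsto.log ?_ hi).const_mul _
      have : Filter.Tendsto (fun e : ℝ => hA.1.eigenvalues i + l * e) (𝓝 0)
        (𝓝 (hA.1.eigenvalues i + l * 0)) := Continuous.tendsto (by fun_prop) _
      simpa using this.mono_left nhdsWithin_le_nhds
  have l2 : Filter.Tendsto
      (fun e : ℝ => ∑ i, auxW hB.1 A i * Real.log (l * (hB.1.eigenvalues i + e))) (𝓝[>] 0)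
      (𝓝 (∑ i, auxW hB.1 A i * (Real.log l + Real.log (hB.1.eigenvalues i)))) := by
    refine tendsto_finsetSum _ fun i _ => ?_
    by_cases hi : hB.1.eigenvalues i = 0
    · simp [aux_W_zero hB.1 hA l h i hi]
    · rw [← Real.log_mul hl.ne' hi]
      refine (Filter.Tendsto.log ?_ (mul_ne_zero hl.ne' hi)).const_mul _
      have : Filter.Tendsto (fun e : ℝ => l * (hB.1.eigenvalues i + e)) (𝓝 0)
        (𝓝 (l * (hB.1.eigenvalues i + 0))) := Continuous.tendsto (by fun_prop) _
      simpa using this.mono_left nhdsWithin_le_nhds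
  have fin := le_of_tendsto_of_tendsto l1 l2
    (by filter_upwards [self_mem_nhdsWithin] with e he using key e he)
  simp only [mul_add, Finset.sum_add_distrib] at fin
  rw [← Finset.sum_mul, aux_sumW, htr] at fin
  rw [relEntropy, Matrix.mul_sub, Matrix.trace_sub, Complex.sub_re, aux_mlog hA.1, aux_mlog hB.1,
    aux_tr_cfc hA.1, aux_tr_cfc hB.1]
  simp only [Real.logb, ← mul_div_assoc, ← Finset.sum_div]
  rw [← sub_div]
  have : 0 < Real.log 2 := Real.log_pos (by norm_num)
  gcongr
  simp at fin
  linarith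

end aux

section aux2
variable {d : ℕ} {s' : Type*} [Fintype s'] [DecidableEq s']

noncomputable def auxV (s' : Type*) [DecidableEq s'] (v : Fin d → ℂ) :
    Matrix (Fin d × s') s' ℂ :=
  Matrix.of fun p t => v p.1 * (if p.2 = t then 1 else 0)

lemma aux_projS (X : Fin d → Fin d → ℂ) (j : Fin d) :
    (projS X j : Matrix (Fin d × s') (Fin d × s') ℂ) = auxV s' (X j) * (auxV s' (X j))ᴴ := by
  ext p q
  simp only [projS, auxV, Matrix.mul_apply, Matrix.of_apply, Matrix.conjTranspose_apply]
  rw [Finset.sum_eq_single p.2]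
  · by_cases h : p.2 = q.2
    · simp [h]
    · simp [h, Ne.symm h]
  · intro b _ hb
    simp [hb.symm]
  · simp

lemma aux_VV (v w : Fin d → ℂ) :
    (auxV s' v)ᴴ * auxV s' w = (∑ i, star (v i) * w i) • (1 : Matrix s' s' ℂ) := by
  ext a b
  simp only [auxV, Matrix.mul_apply, Matrix.of_apply, Matrix.conjTranspose_apply,
    Fintype.sum_prod_type, Matrix.smul_apply, Matrix.one_apply, smul_eq_mul, Finset.sum_mul]
  refine Finset.sum_congr rfl fun i _ => ?_
  rw [Finset.sum_eq_single a]
  · simp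
  · intro c _ hc
    simp [hc]
  · simp

lemma aux_complete {Z : Fin d → Fin d → ℂ} (hZ : IsONB Z) (i i' : Fin d) :
    ∑ k, Z k i * star (Z k i') = if i = i' then 1 else 0 := by
  let U : Matrix (Fin d) (Fin d) ℂ := Matrix.of fun i k => Z k i
  have h : Uᴴ * U = 1 := by
    ext j k
    simpa [U, Matrix.mul_apply, Matrix.one_apply] using hZ j k
  have h2 : U * Uᴴ = 1 := mul_eq_one_comm.1 h
  have := congrFun (congrFun h2 i) i'
  simpa [U, Matrix.mul_apply, Matrix.one_apply] using this

lemma aux_VRV (v : Fin d → ℂ) (R : Matrix s' s' ℂ) (p q : Fin d × s') :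
    (auxV s' v * R * (auxV s' v)ᴴ) p q = v p.1 * star (v q.1) * R p.2 q.2 := by
  rw [Matrix.mul_apply, Finset.sum_eq_single q.2]
  · rw [Matrix.mul_apply, Finset.sum_eq_single p.2]
    · simp [auxV]; ring
    · intro b _ hb
      simp [auxV, hb.symm]
    · simp
  · intro b _ hb
    simp [auxV, hb.symm]
  · simp

lemma aux_sumV {Z : Fin d → Fin d → ℂ} (hZ : IsONB Z) (R : Matrix s' s' ℂ) :
    ∑ k, auxV s' (Z k) * R * (auxV s' (Z k))ᴴ = (1 : Matrix (Fin d) (Fin d) ℂ) ⊗ₖ R := by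
  ext p q
  rw [Matrix.sum_apply, Matrix.kroneckerMap_apply, Matrix.one_apply, ← aux_complete hZ,
    Finset.sum_mul]
  exact Finset.sum_congr rfl fun k _ => aux_VRV _ _ _ _

lemma aux_trS (v : Fin d → ℂ) (hv : ∑ i, star (v i) * v i = 1) (R : Matrix s' s' ℂ) :
    trS (auxV s' v * R * (auxV s' v)ᴴ) = R := by
  ext a b
  simp only [trS, Matrix.of_apply, aux_VRV]
  rw [← Finset.sum_mul]
  simp only [mul_comm (v _), hv, one_mul]

lemma aux_trS_sum {ι : Type*} (t : Finset ι) (f : ι → Matrix (Fin d × s') (Fin d × s') ℂ) :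
    trS (∑ i ∈ t, f i) = ∑ i ∈ t, trS (f i) := by
  ext a b
  simp only [trS, Matrix.of_apply, Matrix.sum_apply]
  rw [Finset.sum_comm]

lemma aux_trace_trS (M : Matrix (Fin d × s') (Fin d × s') ℂ) : (trS M).trace = M.trace := by
  simp only [trS, Matrix.trace, Matrix.diag, Matrix.of_apply, Fintype.sum_prod_type]
  rw [Finset.sum_comm]

lemma aux_deph (X : Fin d → Fin d → ℂ) (ρ : Matrix (Fin d × s') (Fin d × s') ℂ) :
    dephS X ρ = ∑ j, auxV s' (X j) * ((auxV s' (X j))ᴴ * ρ * auxV s' (X j)) * (auxV s' (X j))ᴴ := by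
  simp only [dephS, aux_projS, Matrix.mul_assoc]

lemma aux_overlap (X Z : Fin d → Fin d → ℂ) (j k : Fin d) :
    ∑ i, star (Z k i) * X j i = star (overlap X Z j k) := by
  simp [overlap, mul_comm]

lemma aux_parseval {X Z : Fin d → Fin d → ℂ} (hX : IsONB X) (hZ : IsONB Z) (j : Fin d) :
    ∑ k, ‖overlap X Z j k‖ ^ 2 = 1 := by
  have h : ∑ k, overlap X Z j k * star (overlap X Z j k) = 1 := by
    calc _ = ∑ k, ∑ i, ∑ i', (star (X j i) * X j i') * (Z k i * star (Z k i')) := by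
          refine Finset.sum_congr rfl fun k _ => ?_
          rw [← aux_overlap, overlap, Finset.sum_mul_sum]
          refine Finset.sum_congr rfl fun i _ => Finset.sum_congr rfl fun i' _ => ?_
          ring
      _ = ∑ i, ∑ i', (star (X j i) * X j i') * ∑ k, (Z k i * star (Z k i')) := by
          rw [Finset.sum_comm]
          refine Finset.sum_congr rfl fun i _ => ?_
          rw [Finset.sum_comm]
          simp only [Finset.mul_sum]
      _ = 1 := by
          simp only [aux_complete hZ]
          simpa using hX j j
  have h2 : ((∑ k, ‖overlap X Z j k‖ ^ 2 : ℝ) : ℂ) = 1 := by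
    rw [← h]
    push_cast
    refine Finset.sum_congr rfl fun k _ => ?_
    exact (Complex.mul_conj' _).symm
  exact_mod_cast h2

lemma aux_rho2 (X Z : Fin d → Fin d → ℂ) (ρ : Matrix (Fin d × s') (Fin d × s') ℂ) :
    dephS Z (dephS X ρ) = ∑ k, auxV s' (Z k) *
      (∑ j, (‖overlap X Z j k‖ ^ 2 : ℝ) • ((auxV s' (X j))ᴴ * ρ * auxV s' (X j))) *
        (auxV s' (Z k))ᴴ := by
  rw [aux_deph Z]
  refine Finset.sum_congr rfl fun k _ => ?_
  congr 2
  rw [aux_deph X, Matrix.mul_sum, Matrix.sum_mul]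
  refine Finset.sum_congr rfl fun j _ => ?_
  set R := (auxV s' (X j))ᴴ * ρ * auxV s' (X j)
  have h1 := aux_VV (s' := s') (Z k) (X j)
  have h2 := aux_VV (s' := s') (X j) (Z k)
  rw [aux_overlap] at h1
  calc _ = ((auxV s' (Z k))ᴴ * auxV s' (X j)) * R * ((auxV s' (X j))ᴴ * auxV s' (Z k)) := by
        simp only [Matrix.mul_assoc]
    _ = (star (overlap X Z j k) * overlap X Z j k) • R := by
        rw [h1, h2]
        simp [smul_smul, overlap, mul_comm]
    _ = _ := by
        have : star (overlap X Z j k) * overlap X Z j k = ((‖overlap X Z j k‖ ^ 2 : ℝ) : ℂ) := by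
          push_cast
          exact Complex.conj_mul' _
        rw [this]
        ext a b
        simp

end aux2

/-- decoupling: after sequential X- then Z-dephasing of S,
D(ρ⁽²⁾_SS' ‖ (I/d) ⊗ ρ⁽²⁾_S') ≤ log(d·c). -/
theorem decoupling_bound {d : ℕ} (hd : 0 < d)
    {s' : Type*} [Fintype s'] [DecidableEq s']
    (X Z : Fin d → Fin d → ℂ) (hX : IsONB X) (hZ : IsONB Z)
    (c : ℝ)
    (hc : IsGreatest (Set.range fun jk : Fin d × Fin d => ‖overlap X Z jk.1 jk.2‖ ^ 2) c)
    (ρ : Matrix (Fin d × s') (Fin d × s') ℂ)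
    (hρ : ρ.PosSemidef) (hρ1 : ρ.trace = 1) :
    relEntropy (dephS Z (dephS X ρ))
        (Matrix.of fun p q : Fin d × s' =>
          (if p.1 = q.1 then (1 / d : ℂ) else 0) * trS (dephS Z (dephS X ρ)) p.2 q.2) ≤
      Real.logb 2 (d * c) := by
  classical
  set R : Fin d → Matrix s' s' ℂ := fun j => (auxV s' (X j))ᴴ * ρ * auxV s' (X j) with hR
  have hRp : ∀ j, (R j).PosSemidef := fun j => hρ.conjTranspose_mul_mul_same _
  have hcb : ∀ j k, ‖overlap X Z j k‖ ^ 2 ≤ c := fun j k => hc.2 ⟨(j, k), rfl⟩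
  have hc0 : 0 < c := by
    by_contra hneg
    have h1 := aux_parseval hX hZ (⟨0, hd⟩ : Fin d)
    have h2 : ∑ k, ‖overlap X Z ⟨0, hd⟩ k‖ ^ 2 ≤ 0 :=
      Finset.sum_nonpos fun k _ => (hcb _ k).trans (not_lt.1 hneg)
    linarith
  have h2 := aux_rho2 X Z ρ
  set ρ2 := dephS Z (dephS X ρ) with hρ2
  have htr : trS ρ2 = ∑ j, R j := by
    rw [h2, aux_trS_sum]
    simp only [aux_trS _ ((hZ _ _).trans (if_pos rfl))]
    rw [Finset.sum_comm]
    refine Finset.sum_congr rfl fun j _ => ?_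
    rw [← Finset.sum_smul, aux_parseval hX hZ, one_smul]
  have hd' : (0 : ℝ) < d := by exact_mod_cast hd
  have hσ : (Matrix.of fun p q : Fin d × s' =>
      (if p.1 = q.1 then (1 / d : ℂ) else 0) * trS ρ2 p.2 q.2)
      = (1 / d : ℝ) • ((1 : Matrix (Fin d) (Fin d) ℂ) ⊗ₖ ∑ j, R j) := by
    rw [htr]
    ext p q
    simp [Matrix.kronecker_apply, Matrix.one_apply]
  rw [hσ]
  have hRs : (∑ j, R j).PosSemidef := Matrix.posSemidef_sum _ fun j _ => hRp j
  apply aux_relEntropy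
  · rw [h2]
    refine Matrix.posSemidef_sum _ fun k _ => ?_
    refine Matrix.PosSemidef.mul_mul_conjTranspose_same ?_ _
    exact Matrix.posSemidef_sum _ fun j _ => (hRp j).smul (by positivity)
  · exact (Matrix.PosSemidef.one.kronecker hRs).smul (by positivity)
  · positivity
  · rw [smul_smul, show (d * c) * (1 / d : ℝ) = c by field_simp, ← aux_sumV hZ, h2,
      Finset.smul_sum, ← Finset.sum_sub_distrib]
    refine Matrix.posSemidef_sum _ fun k _ => ?_
    have : c • (auxV s' (Z k) * (∑ j, R j) * (auxV s' (Z k))ᴴ) -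
        auxV s' (Z k) * (∑ j, (‖overlap X Z j k‖ ^ 2 : ℝ) • R j) * (auxV s' (Z k))ᴴ
        = auxV s' (Z k) * (∑ j, (c - ‖overlap X Z j k‖ ^ 2 : ℝ) • R j) * (auxV s' (Z k))ᴴ := by
      simp only [sub_smul, Finset.sum_sub_distrib, Matrix.mul_sub, Matrix.sub_mul,
        ← Finset.smul_sum, Matrix.mul_smul, Matrix.smul_mul]
    rw [this]
    refine Matrix.PosSemidef.mul_mul_conjTranspose_same ?_ _
    exact Matrix.posSemidef_sum _ fun j _ => (hRp j).smul (sub_nonneg.2 (hcb j k))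
  · rw [← aux_trace_trS, htr, Matrix.trace_sum, ← hρ1]
    have hone : ∑ j, auxV s' (X j) * (auxV s' (X j))ᴴ = 1 := by
      have := aux_sumV hX (1 : Matrix s' s' ℂ)
      simpa using this
    calc _ = ∑ j, (ρ * (auxV s' (X j) * (auxV s' (X j))ᴴ)).trace := by
          refine Finset.sum_congr rfl fun j _ => ?_
          rw [hR]
          simp only [Matrix.mul_assoc]
          rw [Matrix.trace_mul_comm]
          simp only [Matrix.mul_assoc]
      _ = ρ.trace := by
          rw [← Matrix.trace_sum, ← Matrix.mul_sum, hone, Matrix.mul_one]
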